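/- Reference trajectory summary (Lemma thm:rt_summary). There exists ε⁰ > 0, depending only on q, p, r, and ε_R, such that for every ε_L ∈ (0, ε⁰) there exists θ⁰ ∈ (0, ε_L] such that for every θ ∈ (0, θ⁰): for every admissible n and every error–erasure pattern for which t_min exists, the smallest t** ∈ T with t** ≥ t_min and p̂_{t**} ≥ p_{t**} exists, and for every t ∈ T with t_min ≤ t ≤ t**, n·r − Λ_t + 2·(n·p − (t − Λ_t)·p_t) ≤ (q−1)(1−ε_L)(1+ε_L)(n − t)/q. -/

import Mathlib

/-- The q-ary entropy function: `H_q(x) = x·log_q(q−1) − x·log_q(x) − (1−x)·log_q(1−x)`.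
With the convention `Real.logb b 0 = 0` this gives `H_q(0) = 0` and `H_q(1) = log_q(q−1)`. -/
noncomputable def Hq (q : ℕ) (x : ℝ) : ℝ :=
  x * Real.logb q ((q : ℝ) - 1) - x * Real.logb q x - (1 - x) * Real.logb q (1 - x)

/-- `α(p̄) = 1 − (2q/(q−1))(p − p̄) − (q/(q−1))r`. -/
noncomputable def alphaEE (q : ℕ) (p r pb : ℝ) : ℝ :=
  1 - (2 * (q : ℝ) / ((q : ℝ) - 1)) * (p - pb) - ((q : ℝ) / ((q : ℝ) - 1)) * r

/-- `C₀(q,p,r) = min_{p̄ ∈ [0,p]} α(p̄)·(1 − H_q(p̄/α(p̄)))` (the minimum is attained,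
so it equals the infimum). -/
noncomputable def C0 (q : ℕ) (p r : ℝ) : ℝ :=
  sInf ((fun pb => alphaEE q p r pb * (1 - Hq q (pb / alphaEE q p r pb))) '' Set.Icc 0 p)

/-- An error–erasure pattern for blocklength `n = s·K` with feedback resolution
`θ = 1/K = s/n`, error fraction `p` and erasure fraction `r`. The time instants of
the set `T = {θn, 2θn, …, (1−θ)n}` are `t = j·s` for `j = 1,…,K−1`; `lam j` is the
cumulative number of erasures among the first `j·s` positions and `E j` the cumulative
number of symbol errors among the first `j·s − lam j` unerased positions. -/
structure EEPattern (p r : ℝ) (n s K : ℕ) where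
  lam : ℕ → ℕ
  E : ℕ → ℕ
  mono_lam : ∀ j : ℕ, 1 ≤ j → j + 1 ≤ K - 1 → lam j ≤ lam (j + 1)
  mono_E : ∀ j : ℕ, 1 ≤ j → j + 1 ≤ K - 1 → E j ≤ E (j + 1)
  lam_le : ∀ j : ℕ, 1 ≤ j → j ≤ K - 1 → lam j ≤ j * s ∧ (lam j : ℝ) ≤ r * n
  E_le : ∀ j : ℕ, 1 ≤ j → j ≤ K - 1 → E j + lam j ≤ j * s ∧ (E j : ℝ) ≤ p * n
  incr : ∀ j : ℕ, 2 ≤ j → j ≤ K - 1 →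
    (lam j - lam (j - 1)) + (E j - E (j - 1)) ≤ s

namespace EEPattern

variable {p r : ℝ} {n s K : ℕ}

/-- The adversary's error trajectory `p_t = E_t/(t − Λ_t)` at time `t = j·s`. -/
noncomputable def pt (P : EEPattern p r n s K) (j : ℕ) : ℝ :=
  (P.E j : ℝ) / (((j * s : ℕ) : ℝ) - (P.lam j : ℝ))

end EEPattern

/-- The set of indices `j` (times `t = j·s ∈ T`) at which `t − Λ_t > n(R + ε_L)`;
`t_min` is its least element. -/
def tminSet (R εL : ℝ) {p r : ℝ} {n s K : ℕ} (P : EEPattern p r n s K) : Set ℕ :=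
  {j : ℕ | 1 ≤ j ∧ j ≤ K - 1 ∧ (n : ℝ) * (R + εL) < ((j * s : ℕ) : ℝ) - (P.lam j : ℝ)}

/-- `phat` is a reference trajectory for the pattern `P` (relative to `jmin = t_min/s`):
for every time `t = j·s ∈ T` with `t ≥ t_min`, `p̂_t ∈ [0,(q−1)/q]` and
`(t − Λ_t)(1 − H_q(p̂_t)) = n(R + ε_L)`. -/
def IsRefTraj (q : ℕ) (R εL : ℝ) {p r : ℝ} {n s K : ℕ}
    (P : EEPattern p r n s K) (jmin : ℕ) (phat : ℕ → ℝ) : Prop :=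
  ∀ j : ℕ, jmin ≤ j → j ≤ K - 1 →
    phat j ∈ Set.Icc (0 : ℝ) (((q : ℝ) - 1) / q) ∧
    (((j * s : ℕ) : ℝ) - (P.lam j : ℝ)) * (1 - Hq q (phat j)) = (n : ℝ) * (R + εL)

lemma Hq_eq_qaryEntropy_div (q : ℕ) (x : ℝ) : Hq q x = Real.qaryEntropy q x / Real.log q := by
  simp only [Hq, Real.logb, Real.qaryEntropy, Real.binEntropy, Real.log_inv]
  push_cast
  ring

lemma Hq_zero (q : ℕ) : Hq q 0 = 0 := by simp [Hq]

lemma log_natCast_pos_of_two_le {q : ℕ} (hq : 2 ≤ q) : 0 < Real.log (q : ℝ) :=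
  Real.log_pos (by exact_mod_cast hq)

lemma Hq_nonneg (q : ℕ) {x : ℝ} (h0 : 0 ≤ x) (h1 : x ≤ 1) : 0 ≤ Hq q x := by
  rw [Hq_eq_qaryEntropy_div]
  exact div_nonneg (Real.qaryEntropy_nonneg h0 h1) (Real.log_natCast_nonneg q)

lemma Hq_strictMonoOn {q : ℕ} (hq : 2 ≤ q) :
    StrictMonoOn (Hq q) (Set.Icc 0 (((q : ℝ) - 1) / q)) := by
  have hq0 : (q : ℝ) ≠ 0 := by positivity
  intro x hx y hy hxy
  rw [show ((q : ℝ) - 1) / q = 1 - 1 / q by field_simp] at hx hy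
  rw [Hq_eq_qaryEntropy_div, Hq_eq_qaryEntropy_div]
  exact div_lt_div_of_pos_right (Real.qaryEntropy_strictMonoOn hq hx hy hxy)
    (log_natCast_pos_of_two_le hq)

lemma Hq_sub_one_div {q : ℕ} (hq : 2 ≤ q) : Hq q (((q : ℝ) - 1) / q) = 1 := by
  have hq2 : (2 : ℝ) ≤ q := by exact_mod_cast hq
  have hq1 : (q : ℝ) - 1 ≠ 0 := by linarith
  have hq0 : (q : ℝ) ≠ 0 := by linarith
  have hl : Real.log (q : ℝ) ≠ 0 := (log_natCast_pos_of_two_le hq).ne'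
  have hc : 1 - ((q : ℝ) - 1) / q = 1 / q := by field_simp; ring
  simp only [Hq, Real.logb, hc]
  rw [Real.log_div hq1 hq0, Real.log_div one_ne_zero hq0, Real.log_one]
  field_simp
  ring

lemma Hq_le_one {q : ℕ} (hq : 2 ≤ q) {x : ℝ} (h0 : 0 ≤ x) (h1 : x ≤ ((q : ℝ) - 1) / q) :
    Hq q x ≤ 1 := by
  rw [← Hq_sub_one_div hq]
  exact (Hq_strictMonoOn hq).monotoneOn ⟨h0, h1⟩ ⟨h0.trans h1, le_rfl⟩ h1

lemma concaveOn_Hq (q : ℕ) : ConcaveOn ℝ (Set.Icc 0 1) (Hq q) := by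
  have h := (Real.strictConcaveOn_qaryEntropy (q := q)).concaveOn.smul
    (inv_nonneg.2 (Real.log_natCast_nonneg q))
  refine h.congr fun x _ => ?_
  simp only [Hq_eq_qaryEntropy_div, smul_eq_mul]
  ring

/-- The perspective `u ↦ u·H_q(e/u)` is nondecreasing. -/
lemma mul_Hq_div_mono (q : ℕ) {e u v : ℝ} (he : 0 ≤ e) (hu : 0 < u) (heu : e ≤ u) (huv : u ≤ v) :
    u * Hq q (e / u) ≤ v * Hq q (e / v) := by
  have hv : 0 < v := hu.trans_le huv
  have hx : e / u ∈ Set.Icc (0 : ℝ) 1 := ⟨by positivity, (div_le_one hu).2 heu⟩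
  have h := (concaveOn_Hq q).2 hx (Set.left_mem_Icc.2 zero_le_one)
    (show 0 ≤ u / v by positivity) (sub_nonneg.2 ((div_le_one hv).2 huv)) (by ring)
  simp only [smul_eq_mul, mul_zero, add_zero, Hq_zero] at h
  rw [show u / v * (e / u) = e / v by field_simp] at h
  calc u * Hq q (e / u) = v * (u / v * Hq q (e / u)) := by field_simp
    _ ≤ v * Hq q (e / v) := by gcongr

/-- The function `u ↦ u·(1 − H_q(e/u))` is nondecreasing as long as `e/u ≤ (q−1)/q`. -/
lemma mul_one_sub_Hq_div_mono {q : ℕ} (hq : 2 ≤ q) {e u v : ℝ} (he : 0 ≤ e) (hu : 0 < u)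
    (heu : e / u ≤ ((q : ℝ) - 1) / q) (huv : u ≤ v) :
    u * (1 - Hq q (e / u)) ≤ v * (1 - Hq q (e / v)) := by
  have hv : 0 < v := hu.trans_le huv
  have hle : e / v ≤ e / u := by gcongr
  have hmono := (Hq_strictMonoOn hq).monotoneOn
    ⟨div_nonneg he hv.le, hle.trans heu⟩ ⟨div_nonneg he hu.le, heu⟩ hle
  exact mul_le_mul huv (by linarith) (sub_nonneg.2 (Hq_le_one hq (by positivity) heu)) hv.le

lemma mul_alphaEE {q : ℕ} (hq : 2 ≤ q) (p r e : ℝ) :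
    ((q : ℝ) - 1) / q * alphaEE q p r e = ((q : ℝ) - 1) / q - 2 * (p - e) - r := by
  have hq2 : (2 : ℝ) ≤ q := by exact_mod_cast hq
  have hq1 : (q : ℝ) - 1 ≠ 0 := by linarith
  have hq0 : (q : ℝ) ≠ 0 := by linarith
  rw [alphaEE]
  field_simp

lemma sub_one_div_mem_Ioo {q : ℕ} (hq : 2 ≤ q) : ((q : ℝ) - 1) / q ∈ Set.Ioo (0 : ℝ) 1 := by
  have hq2 : (2 : ℝ) ≤ q := by exact_mod_cast hq
  exact ⟨div_pos (by linarith) (by linarith), (div_lt_one (by linarith)).2 (by linarith)⟩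

lemma alphaEE_sub_pos {q : ℕ} (hq : 2 ≤ q) {p r e c : ℝ} (he : 0 ≤ e)
    (hc : 0 ≤ c) (hc' : c < ((q : ℝ) - 1) / q - 2 * p - r) :
    0 < alphaEE q p r e - c ∧ e / (alphaEE q p r e - c) ≤ ((q : ℝ) - 1) / q := by
  obtain ⟨hβ0, hβ1⟩ := sub_one_div_mem_Ioo hq
  have hα := mul_alphaEE hq p r e
  have hlt : e < ((q : ℝ) - 1) / q * (alphaEE q p r e - c) := by nlinarith
  have hpos : 0 < alphaEE q p r e - c := pos_of_mul_pos_right (he.trans_lt hlt) hβ0.le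
  exact ⟨hpos, (div_le_iff₀ hpos).2 hlt.le⟩

lemma C0_le {q : ℕ} (hq : 2 ≤ q) {p r e : ℝ} (hpr : 2 * p + r < ((q : ℝ) - 1) / q)
    (he : e ∈ Set.Icc 0 p) :
    C0 q p r ≤ alphaEE q p r e * (1 - Hq q (e / alphaEE q p r e)) := by
  refine csInf_le ⟨0, ?_⟩ ⟨e, he, rfl⟩
  rintro _ ⟨x, hx, rfl⟩
  obtain ⟨hα, hxα⟩ := alphaEE_sub_pos hq (p := p) (r := r) hx.1 le_rfl (by linarith)
  rw [sub_zero] at hα hxα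
  exact mul_nonneg hα.le (sub_nonneg.2 (Hq_le_one hq (div_nonneg hx.1 hα.le) hxα))

/-- If the unerased fraction `u` is at least `α(e) − c`, then the residual information
`u·(1 − H_q(e/u))` is at least `C₀ − c`. -/
lemma C0_sub_le_mul_one_sub_Hq {q : ℕ} (hq : 2 ≤ q) {p r e c u : ℝ}
    (he : e ∈ Set.Icc 0 p) (hc : 0 ≤ c) (hc' : c < ((q : ℝ) - 1) / q - 2 * p - r)
    (hu : alphaEE q p r e - c ≤ u) :
    0 < u ∧ e / u ≤ ((q : ℝ) - 1) / q ∧ C0 q p r - c ≤ u * (1 - Hq q (e / u)) := by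
  obtain ⟨hα, heα⟩ := alphaEE_sub_pos hq he.1 hc hc'
  have hle : e ≤ alphaEE q p r e - c :=
    (div_le_one hα).1 (heα.trans (sub_one_div_mem_Ioo hq).2.le)
  have hdiv : e / u ≤ e / (alphaEE q p r e - c) := div_le_div_of_nonneg_left he.1 hα hu
  refine ⟨hα.trans_le hu, hdiv.trans heα, ?_⟩
  have h1 := mul_one_sub_Hq_div_mono hq he.1 hα heα hu
  have h2 := mul_Hq_div_mono q he.1 hα hle (sub_le_self _ hc)
  have h3 := C0_le hq (show 2 * p + r < _ by linarith) he
  linarith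

/-- Reference trajectory summary (Lemma thm:rt_summary). There exists
ε⁰ > 0, depending only on q, p, r, ε_R, such that for every ε_L ∈ (0, ε⁰) there exists
θ⁰ ∈ (0, ε_L] such that for every θ ∈ (0, θ⁰): for every admissible n and every
error–erasure pattern for which t_min exists, the smallest t** ∈ T with t** ≥ t_min
and p̂_{t**} ≥ p_{t**} exists, and for every t ∈ T with t_min ≤ t ≤ t**,
n·r − Λ_t + 2·(n·p − (t − Λ_t)·p_t) ≤ (q−1)(1−ε_L)(1+ε_L)(n − t)/q. -/
theorem reference_trajectory_summary (q : ℕ) (hq : 2 ≤ q) (p r : ℝ)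
    (hp : p ∈ Set.Icc (0 : ℝ) 1) (hr : r ∈ Set.Icc (0 : ℝ) 1)
    (hpr : 2 * p + r < ((q : ℝ) - 1) / q)
    (εR : ℝ) (hεR0 : 0 < εR) (hεR1 : εR < C0 q p r) :
    ∃ ε0 : ℝ, 0 < ε0 ∧ ∀ εL : ℝ, 0 < εL → εL < ε0 →
      ∃ θ0 : ℝ, 0 < θ0 ∧ θ0 ≤ εL ∧
      ∀ (θ : ℝ) (n s K : ℕ), 0 < θ → θ < θ0 → 0 < s →
        (s : ℝ) = θ * n → (K : ℝ) = 1 / θ →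
      ∀ P : EEPattern p r n s K, ∀ jmin : ℕ,
        IsLeast (tminSet (C0 q p r - εR) εL P) jmin →
      ∀ phat : ℕ → ℝ, IsRefTraj q (C0 q p r - εR) εL P jmin phat →
      ∃ jss : ℕ,
        IsLeast {j : ℕ | jmin ≤ j ∧ j ≤ K - 1 ∧ P.pt j ≤ phat j} jss ∧
        ∀ j : ℕ, jmin ≤ j → j ≤ jss →
          (n : ℝ) * r - P.lam j +
              2 * ((n : ℝ) * p - (((j * s : ℕ) : ℝ) - P.lam j) * P.pt j) ≤
            ((q : ℝ) - 1) * (1 - εL) * (1 + εL) * ((n : ℝ) - ((j * s : ℕ) : ℝ)) / q := by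
  obtain ⟨hβ0, hβ1⟩ := sub_one_div_mem_Ioo hq
  set β : ℝ := ((q : ℝ) - 1) / q with hβ
  obtain ⟨c, hc0, hcβ, hcR⟩ : ∃ c : ℝ, 0 < c ∧ c < β - 2 * p - r ∧ 2 * c ≤ εR :=
    ⟨min ((β - 2 * p - r) / 2) (εR / 2), by apply lt_min <;> linarith,
      (min_le_left _ _).trans_lt (by linarith),
      by linarith [min_le_right ((β - 2 * p - r) / 2) (εR / 2)]⟩
  have hc1 : c < 1 := by linarith [hp.1, hr.1]
  refine ⟨c / 2, by positivity, fun εL hL0 hLc => ⟨εL, hL0, le_rfl, ?_⟩⟩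
  intro θ n s K hθ0 hθL hs hsθ hK P jmin hjmin phat hphat
  have hs0 : (0 : ℝ) < s := by exact_mod_cast hs
  have hn0 : (0 : ℝ) < n := by
    rw [hsθ] at hs0
    exact pos_of_mul_pos_right hs0 hθ0.le
  have hKs : (K : ℝ) * s = n := by rw [hK, hsθ]; field_simp
  obtain ⟨⟨hj1, hjK, hjR⟩, hjleast⟩ := hjmin
  have hE : ∀ j, 1 ≤ j → j ≤ K - 1 → (P.E j : ℝ) / n ∈ Set.Icc 0 p := fun j h1 h2 =>
    ⟨by positivity, (div_le_iff₀ hn0).2 (P.E_le j h1 h2).2⟩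
  have hα (j : ℕ) : β * (alphaEE q p r (P.E j / n) * n) = β * n - 2 * (n * p - P.E j) - r * n := by
    rw [← mul_assoc, mul_alphaEE hq, ← hβ]
    field_simp [hn0.ne']
  have key : ∀ j, 1 ≤ j → j ≤ K - 1 →
      (alphaEE q p r (P.E j / n) - c) * n ≤ ((j * s : ℕ) : ℝ) - P.lam j →
      0 < ((j * s : ℕ) : ℝ) - P.lam j ∧ P.pt j ∈ Set.Icc 0 β ∧
      (C0 q p r - c) * n ≤ (((j * s : ℕ) : ℝ) - P.lam j) * (1 - Hq q (P.pt j)) := by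
    intro j h1 h2 h
    obtain ⟨hu, hx, hC⟩ := C0_sub_le_mul_one_sub_Hq hq (hE j h1 h2) hc0.le hcβ
      ((le_div_iff₀ hn0).2 h)
    have hdiv : (P.E j : ℝ) / n / ((((j * s : ℕ) : ℝ) - P.lam j) / n) = P.pt j := by
      rw [EEPattern.pt]
      field_simp
    rw [hdiv] at hx hC
    have hu' := (div_pos_iff_of_pos_right hn0).1 hu
    refine ⟨hu', ⟨div_nonneg (Nat.cast_nonneg _) hu'.le, hx⟩, ?_⟩
    rw [← le_div_iff₀ hn0]
    exact hC.trans_eq (by ring)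
  have hcross : ∀ j, jmin ≤ j → j ≤ K - 1 →
      (alphaEE q p r (P.E j / n) - c) * n ≤ ((j * s : ℕ) : ℝ) - P.lam j → P.pt j ≤ phat j := by
    intro j h1 h2 h
    obtain ⟨hu, hx, hC⟩ := key j (hj1.trans h1) h2 h
    obtain ⟨hph, hR⟩ := hphat j h1 h2
    by_contra! hlt
    have hH := mul_lt_mul_of_pos_left (Hq_strictMonoOn hq hph hx hlt) hu
    have hgap : 0 < (εR - εL - c) * n := mul_pos (by linarith) hn0
    linarith
  have hslack : ∀ j, 1 ≤ j → j ≤ K - 1 →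
      ((j * s : ℕ) : ℝ) - P.lam j ≤ (alphaEE q p r (P.E j / n) - c) * n →
      (n : ℝ) * r - P.lam j + 2 * (n * p - P.E j) ≤ β * (n - ((j * s : ℕ) : ℝ)) - β * (c * n) := by
    intro j h1 h2 h
    have h3 := hα j
    have h4 := mul_le_mul_of_nonneg_left h hβ0.le
    have h5 : β * (P.lam j : ℝ) ≤ P.lam j := mul_le_of_le_one_left (Nat.cast_nonneg _) hβ1.le
    linarith
  have hlast : {j : ℕ | jmin ≤ j ∧ j ≤ K - 1 ∧ P.pt j ≤ phat j}.Nonempty := by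
    refine ⟨K - 1, hjK, le_rfl, hcross _ hjK le_rfl ?_⟩
    have hcast : (((K - 1) * s : ℕ) : ℝ) = n - s := by
      rw [Nat.cast_mul, Nat.cast_sub (by lia), sub_mul, hKs]
      simp
    rw [hcast]
    have h1 := hα (K - 1)
    obtain ⟨-, hEp⟩ := P.E_le (K - 1) (by lia) le_rfl
    obtain ⟨-, hlr⟩ := P.lam_le (K - 1) (by lia) le_rfl
    have h2 : s ≤ c * n := by rw [hsθ]; gcongr; linarith
    have h3 : β * (r * n) ≤ r * n := mul_le_of_le_one_left (mul_nonneg hr.1 hn0.le) hβ1.le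
    have h4 : alphaEE q p r (P.E (K - 1) / n) * n ≤ n - r * n := by
      refine le_of_mul_le_mul_left ?_ hβ0
      linarith
    linarith
  obtain ⟨jss, hjss⟩ : ∃ jss, IsLeast {j : ℕ | jmin ≤ j ∧ j ≤ K - 1 ∧ P.pt j ≤ phat j} jss :=
    ⟨_, isLeast_csInf hlast⟩
  refine ⟨jss, hjss, fun j hj hjs => ?_⟩
  obtain ⟨⟨hss1, hssK, -⟩, hssleast⟩ := hjss
  have h1j : 1 ≤ j := hj1.trans hj
  have hjK' : j ≤ K - 1 := hjs.trans hssK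
  -- Up to one extra block, the slack bound holds at every time up to the crossing.
  have hbound : (n : ℝ) * r - P.lam j + 2 * (n * p - P.E j) ≤
      β * (n - ((j * s : ℕ) : ℝ)) - β * (c * n) + β * s := by
    have hβs : 0 ≤ β * s := by positivity
    rcases le_or_gt (((j * s : ℕ) : ℝ) - P.lam j) ((alphaEE q p r (P.E j / n) - c) * n) with h | h
    · linarith [hslack j h1j hjK' h]
    rcases hj.eq_or_lt with rfl | hlt
    · exfalso
      obtain ⟨hu, hx, hC⟩ := key jmin h1j hjK' h.le
      have hH := Hq_nonneg q hx.1 (hx.2.trans hβ1.le)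
      have hprev : ((jmin * s : ℕ) : ℝ) - P.lam jmin ≤ n * (C0 q p r - εR + εL) + s := by
        rcases hj1.eq_or_lt with rfl | h2
        · have hR : 0 ≤ n * (C0 q p r - εR + εL) := mul_nonneg hn0.le (by linarith)
          have hl : (0 : ℝ) ≤ P.lam 1 := Nat.cast_nonneg _
          rw [one_mul]
          linarith
        · obtain ⟨i, rfl⟩ : ∃ i, jmin = i + 1 := ⟨jmin - 1, by lia⟩
          have hi1 : 1 ≤ i := by lia
          have hi : ((i * s : ℕ) : ℝ) - P.lam i ≤ n * (C0 q p r - εR + εL) := by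
            by_contra! hi
            have := hjleast ⟨hi1, by lia, hi⟩
            lia
          have hl : (P.lam i : ℝ) ≤ P.lam (i + 1) := by exact_mod_cast P.mono_lam i hi1 hjK'
          push_cast at hi ⊢
          linarith
      have hle : (((jmin * s : ℕ) : ℝ) - P.lam jmin) * (1 - Hq q (P.pt jmin)) ≤
          ((jmin * s : ℕ) : ℝ) - P.lam jmin := mul_le_of_le_one_right hu.le (by linarith)
      have : (s : ℝ) < εL * n := by rw [hsθ]; gcongr
      have hgap : 0 < (εR - 2 * εL - c) * n := mul_pos (by linarith) hn0
      linarith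
    · obtain ⟨i, rfl⟩ : ∃ i, j = i + 1 := ⟨j - 1, by lia⟩
      have hi1 : 1 ≤ i := by lia
      have hiK : i ≤ K - 1 := by lia
      have hnot : ¬ P.pt i ≤ phat i := fun hi => by
        have := hssleast ⟨(by lia : jmin ≤ i), hiK, hi⟩
        lia
      have hi := hslack i hi1 hiK
        (not_le.1 (mt (hcross i (by lia) hiK) hnot)).le
      have hl : (P.lam i : ℝ) ≤ P.lam (i + 1) := by exact_mod_cast P.mono_lam i hi1 hjK'
      have he : (P.E i : ℝ) ≤ P.E (i + 1) := by exact_mod_cast P.mono_E i hi1 hjK'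
      push_cast at hi ⊢
      linarith
  have hu : ((j * s : ℕ) : ℝ) - P.lam j ≠ 0 := by
    have hR : 0 < n * (C0 q p r - εR + εL) := mul_pos hn0 (by linarith)
    exact left_ne_zero_of_mul ((hphat j hj hjK').2.trans_ne hR.ne')
  have hpt : (((j * s : ℕ) : ℝ) - P.lam j) * P.pt j = P.E j := mul_div_cancel₀ _ hu
  rw [hpt]
  have hfin : ((q : ℝ) - 1) * (1 - εL) * (1 + εL) * ((n : ℝ) - ((j * s : ℕ) : ℝ)) / q =
      β * (n - ((j * s : ℕ) : ℝ)) - β * (εL ^ 2 * (n - ((j * s : ℕ) : ℝ))) := by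
    rw [hβ]; ring
  rw [hfin]
  have hsq : εL ^ 2 * (n - ((j * s : ℕ) : ℝ)) + s ≤ c * n := by
    have h0 : (0 : ℝ) ≤ ((j * s : ℕ) : ℝ) := Nat.cast_nonneg _
    have h1 : εL ^ 2 * (n - ((j * s : ℕ) : ℝ)) ≤ εL ^ 2 * n := by gcongr; linarith
    have hL2 : εL ^ 2 ≤ c / 2 := (pow_le_of_le_one hL0.le (by linarith) two_ne_zero).trans hLc.le
    have h2 : εL ^ 2 * n ≤ c / 2 * n := by gcongr
    have h3 : (s : ℝ) ≤ c / 2 * n := by rw [hsθ]; gcongr; linarith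
    linarith
  linarith [mul_le_mul_of_nonneg_left hsq hβ0.le]
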